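/- arXiv:1707.01018 — 4 statements merged into one kernel-verified Lean document; each statement's English description precedes it below -/
import Mathlib

section
/- Let m, n ≥ 1, let φ : ℝ → ℝ be an admissible M-estimator, and for i ∈ {1,…,m}, j ∈ {1,…,n} let ζ_{ij} : ℝⁿ → ℝ be twice continuously differentiable and I_{ij} ∈ ℝ. Define the residuals r_{ij}(ρ,z) = ρ_j ζ_{ij}(z) − I_{ij}, the energy E(ρ,z) = ∑_{i,j} φ(r_{ij}(ρ,z)), the weights w_{ij}(ρ,z) = φ'(r_{ij}(ρ,z))/r_{ij}(ρ,z) when r_{ij}(ρ,z) ≠ 0 and 0 otherwise, the diagonal n×n matrix H_ρ(ρ,z) whose (j,j) entry is ∑_i w_{ij}(ρ,z) ζ_{ij}(z)², the n×n matrix H_z(ρ,z) = ∑_{i,j} w_{ij}(ρ,z) ρ_j² ∇ζ_{ij}(z) ∇ζ_{ij}(z)ᵀ, and the Gauss–Newton Hessian G(ρ,z) = ∑_{i,j} φ''(r_{ij}(ρ,z)) ρ_j² ∇ζ_{ij}(z) ∇ζ_{ij}(z)ᵀ. Consider the alternating reweighted least-squares (ARLS) iteration ρ^{(k+1)} = ρ^{(k)}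 − H_ρ(ρ^{(k)},z^{(k)})⁻¹ ∇_ρ E(ρ^{(k)},z^{(k)}), z^{(k+1)} = z^{(k)} − H_z(ρ^{(k+1)},z^{(k)})⁻¹ ∇_z E(ρ^{(k+1)},z^{(k)}). Suppose (ρ*,z*) satisfies: (i) ζ_{ij}(z*) ≠ 0 and r_{ij}(ρ*,z*) ≠ 0 for all i,j; (ii) ∇_ρ E(ρ*,z*) = 0 and ∇_z E(ρ*,z*) = 0; (iii) the full 2n×2n Hessian of E at (ρ*,z*) is positive definite; (iv) G(ρ*,z*) is positive definite; (v) the spectral radius of G(ρ*,z*)⁻¹ (∇²_{zz} E(ρ*,z*) − G(ρ*,z*)) is strictly less than 1. Then there exists a neighborhood U of (ρ*,z*) such that for every starting point (ρ^{(0)},z^{(0)}) ∈ U the ARLS iterates are well defined and lim_{k→∞} (ρ^{(k)},z^{(k)}) = (ρ*,z*). (Theorem 1 of the paper.) -/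
open Matrix Filter Topology

/-- Partial derivative of `f : (ι → ℝ) → ℝ` with respect to the `j`-th coordinate. -/
noncomputable def pd {ι : Type*} [DecidableEq ι] (f : (ι → ℝ) → ℝ) (x : ι → ℝ) (j : ι) : ℝ :=
  deriv (fun t => f (Function.update x j t)) (x j)

namespace ARLS

variable {m n : ℕ}
variable (φ : ℝ → ℝ) (ζ : Fin m → Fin n → (Fin n → ℝ) → ℝ) (I : Fin m → Fin n → ℝ)

/-- Residual `r_{ij}(ρ,z) = ρ_j ζ_{ij}(z) − I_{ij}`. -/
noncomputable def res (i : Fin m) (j : Fin n) (ρ z : Fin n → ℝ) : ℝ :=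
  ρ j * ζ i j z - I i j

/-- Robust energy `E(ρ,z) = ∑_{i,j} φ(r_{ij}(ρ,z))`. -/
noncomputable def E (ρ z : Fin n → ℝ) : ℝ :=
  ∑ i, ∑ j, φ (res ζ I i j ρ z)

/-- Lagged weights `w_{ij}(ρ,z) = φ'(r_{ij})/r_{ij}` (set to `0` when `r_{ij} = 0`). -/
noncomputable def w (i : Fin m) (j : Fin n) (ρ z : Fin n → ℝ) : ℝ :=
  if res ζ I i j ρ z = 0 then 0 else deriv φ (res ζ I i j ρ z) / res ζ I i j ρ z

/-- Gradient vector `∇ζ_{ij}(z) ∈ ℝⁿ`. -/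
noncomputable def gradζ (i : Fin m) (j : Fin n) (z : Fin n → ℝ) : Fin n → ℝ :=
  fun l => pd (ζ i j) z l

/-- Diagonal surrogate Hessian `H_ρ(ρ,z)` with `(j,j)` entry `∑_i w_{ij} ζ_{ij}(z)²`. -/
noncomputable def Hρ (ρ z : Fin n → ℝ) : Matrix (Fin n) (Fin n) ℝ :=
  Matrix.diagonal fun j => ∑ i, w φ ζ I i j ρ z * (ζ i j z) ^ 2

/-- Surrogate Hessian `H_z(ρ,z) = ∑_{i,j} w_{ij} ρ_j² ∇ζ_{ij} ∇ζ_{ij}ᵀ`. -/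
noncomputable def Hz (ρ z : Fin n → ℝ) : Matrix (Fin n) (Fin n) ℝ :=
  ∑ i, ∑ j, (w φ ζ I i j ρ z * (ρ j) ^ 2) • Matrix.vecMulVec (gradζ ζ i j z) (gradζ ζ i j z)

/-- Gauss–Newton Hessian `G(ρ,z) = ∑_{i,j} φ''(r_{ij}) ρ_j² ∇ζ_{ij} ∇ζ_{ij}ᵀ`. -/
noncomputable def G (ρ z : Fin n → ℝ) : Matrix (Fin n) (Fin n) ℝ :=
  ∑ i, ∑ j, (deriv (deriv φ) (res ζ I i j ρ z) * (ρ j) ^ 2) •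
    Matrix.vecMulVec (gradζ ζ i j z) (gradζ ζ i j z)

/-- Partial gradient `∇_ρ E(ρ,z)`. -/
noncomputable def gradρE (ρ z : Fin n → ℝ) : Fin n → ℝ :=
  fun j => pd (fun ρ' => E φ ζ I ρ' z) ρ j

/-- Partial gradient `∇_z E(ρ,z)`. -/
noncomputable def gradzE (ρ z : Fin n → ℝ) : Fin n → ℝ :=
  fun l => pd (fun z' => E φ ζ I ρ z') z l

/-- Partial Hessian `∇²_{zz} E(ρ,z)`. -/
noncomputable def hesszzE (ρ z : Fin n → ℝ) : Matrix (Fin n) (Fin n) ℝ :=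
  Matrix.of fun j l => pd (fun z' => gradzE φ ζ I ρ z' l) z j

/-- The energy as a function of the concatenated variable `(ρ,z) ∈ ℝ^{2n}`. -/
noncomputable def fullE (x : (Fin n ⊕ Fin n) → ℝ) : ℝ :=
  E φ ζ I (x ∘ Sum.inl) (x ∘ Sum.inr)

/-- The full `2n×2n` Hessian of `E` at `(ρ,z)`. -/
noncomputable def fullHess (ρ z : Fin n → ℝ) : Matrix (Fin n ⊕ Fin n) (Fin n ⊕ Fin n) ℝ :=
  Matrix.of fun a b => pd (fun x => pd (fullE φ ζ I) x b) (Sum.elim ρ z) a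

/-- The ARLS albedo half-update `ρ ↦ ρ − H_ρ(ρ,z)⁻¹ ∇_ρE(ρ,z)`. -/
noncomputable def stepρ (p : (Fin n → ℝ) × (Fin n → ℝ)) : Fin n → ℝ :=
  p.1 - (Hρ φ ζ I p.1 p.2)⁻¹.mulVec (gradρE φ ζ I p.1 p.2)

/-- One full ARLS iteration: `ρ⁺ = ρ − H_ρ(ρ,z)⁻¹ ∇_ρE(ρ,z)` followed by
`z⁺ = z − H_z(ρ⁺,z)⁻¹ ∇_zE(ρ⁺,z)`. -/
noncomputable def step (p : (Fin n → ℝ) × (Fin n → ℝ)) : (Fin n → ℝ) × (Fin n → ℝ) :=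
  (stepρ φ ζ I p,
   p.2 - (Hz φ ζ I (stepρ φ ζ I p) p.2)⁻¹.mulVec (gradzE φ ζ I (stepρ φ ζ I p) p.2))


lemma local_conv {P : Type*} [NormedAddCommGroup P] [NormedSpace ℝ P] [FiniteDimensional ℝ P]
    (f : P → P) (T : P →L[ℝ] P) (x : P) (hf : HasFDerivAt f T x) (hfx : f x = x)
    (Q : P → ℝ) (hQc : Continuous Q) (hQh : ∀ (c : ℝ) y, Q (c • y) = c ^ 2 * Q y)
    (hQp : ∀ y, y ≠ 0 → 0 < Q y) (hQT : ∀ y, y ≠ 0 → Q (T y) < Q y)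
    (W : Set P) (hW : W ∈ 𝓝 x) :
    ∃ U ∈ 𝓝 x, ∀ p ∈ U, (∀ k : ℕ, f^[k] p ∈ W) ∧ Tendsto (fun k => f^[k] p) atTop (𝓝 x) := by
  have : ProperSpace P := FiniteDimensional.proper ℝ P
  have hS : IsCompact (Metric.sphere (0 : P) 1) := isCompact_sphere _ _
  have hne : ∀ y ∈ Metric.sphere (0 : P) 1, y ≠ 0 := by
    intro y hy h; simp [h] at hy
  have hQ0 : Q 0 = 0 := by simpa using hQh 0 0
  -- contraction
  have h1 : ∀ᶠ q : ℝ × P in 𝓝 (1, 0), ∀ y ∈ Metric.sphere (0 : P) 1, Q (T y + q.2) < q.1 * Q y := by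
    refine hS.eventually_forall_of_forall_eventually (P := fun (q : ℝ × P) y => Q (T y + q.2) < q.1 * Q y) ?_
    intro y hy
    apply ContinuousAt.eventually_lt
    · fun_prop
    · fun_prop
    · simpa using hQT y (hne y hy)
  have h2 : ∀ᶠ μ : ℝ in 𝓝 0, ∀ y ∈ Metric.sphere (0 : P) 1, μ < Q y := by
    refine hS.eventually_forall_of_forall_eventually (P := fun (q : ℝ) y => q < Q y) ?_
    intro y hy
    apply ContinuousAt.eventually_lt
    · fun_prop
    · fun_prop
    · simpa using hQp y (hne y hy)
  obtain ⟨μ, hμ0, hμ⟩ : ∃ μ : ℝ, 0 < μ ∧ ∀ y ∈ Metric.sphere (0 : P) 1, μ < Q y := by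
    obtain ⟨ε, hε, h⟩ := Metric.eventually_nhds_iff.1 h2
    exact ⟨ε / 2, by positivity, h (by simp [abs_of_pos hε]; linarith)⟩
  obtain ⟨c, δ, hc0, hc1, hδ, hc⟩ : ∃ c δ : ℝ, 0 < c ∧ c < 1 ∧ 0 < δ ∧ ∀ e : P, ‖e‖ ≤ δ →
      ∀ y ∈ Metric.sphere (0 : P) 1, Q (T y + e) < c * Q y := by
    obtain ⟨ε, hε, h⟩ := Metric.eventually_nhds_iff.1 h1
    have hm : 0 < min ε 1 := by positivity
    refine ⟨1 - min ε 1 / 2, ε / 2, ?_, ?_, by positivity, ?_⟩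
    · have := min_le_right ε 1; linarith
    · linarith
    · intro e he
      refine h (y := (_, e)) ?_
      rw [Prod.dist_eq, max_lt_iff]
      constructor
      · simp only [Real.dist_eq]
        rw [abs_lt]; have := min_le_left ε 1
        constructor <;> linarith
      · simp; linarith
  have hlow : ∀ y, μ * ‖y‖ ^ 2 ≤ Q y := by
    intro y
    by_cases hy : y = 0
    · simp [hy, hQ0]
    have hn : 0 < ‖y‖ := norm_pos_iff.2 hy
    have h := hμ (‖y‖⁻¹ • y) (by simp [norm_smul, hn.ne'])
    rw [hQh] at h
    have : Q y = ‖y‖ ^ 2 * (‖y‖⁻¹ ^ 2 * Q y) := by field_simp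
    rw [this]; nlinarith [sq_nonneg ‖y‖]
  have hcon : ∀ y e, ‖e‖ ≤ δ * ‖y‖ → Q (T y + e) ≤ c * Q y := by
    intro y e he
    by_cases hy : y = 0
    · have : e = 0 := by simpa [hy] using he
      simp [hy, this, hQ0]
    have hn : 0 < ‖y‖ := norm_pos_iff.2 hy
    have h := hc (‖y‖⁻¹ • e) (by
      rw [norm_smul, norm_inv, norm_norm, inv_mul_le_iff₀ hn]; linarith) (‖y‖⁻¹ • y) (by simp [norm_smul, hn.ne'])
    rw [map_smul, ← smul_add, hQh, hQh] at h
    have h3 : 0 < ‖y‖⁻¹ ^ 2 := by positivity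
    have h4 : ‖y‖⁻¹ ^ 2 * Q (T y + e) < ‖y‖⁻¹ ^ 2 * (c * Q y) := by linarith
    exact (lt_of_mul_lt_mul_left h4 h3.le).le
  have h5 : ∀ᶠ p in 𝓝 x, Q (f p - x) ≤ c * Q (p - x) := by
    filter_upwards [hf.isLittleO.bound hδ] with p hp
    have := hcon (p - x) (f p - x - T (p - x)) (by simpa [hfx] using hp)
    simpa using this
  obtain ⟨r, hr, hball⟩ := Metric.mem_nhds_iff.1 (Filter.inter_mem h5 hW)
  have hUr : ∀ p, Q (p - x) < μ * r ^ 2 → p ∈ Metric.ball x r := by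
    intro p hp
    have h := (hlow (p - x)).trans_lt hp
    have : ‖p - x‖ ^ 2 < r ^ 2 := lt_of_mul_lt_mul_left h hμ0.le
    rw [Metric.mem_ball, dist_eq_norm]
    exact lt_of_pow_lt_pow_left₀ 2 hr.le this
  have hQnn : ∀ y, 0 ≤ Q y := fun y => le_trans (by positivity) (hlow y)
  refine ⟨{p | Q (p - x) < μ * r ^ 2}, ?_, ?_⟩
  · refine IsOpen.mem_nhds (isOpen_lt (by fun_prop) (by fun_prop)) ?_
    simp only [Set.mem_ofPred_eq, sub_self, hQ0]; positivity
  intro p hp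
  have hp' : Q (p - x) < μ * r ^ 2 := hp
  have hk : ∀ k : ℕ, Q (f^[k] p - x) ≤ c ^ k * Q (p - x) ∧ Q (f^[k] p - x) < μ * r ^ 2 := by
    intro k
    induction k with
    | zero => simpa using hp
    | succ k ih =>
      rw [Function.iterate_succ_apply']
      have h := (hball (hUr _ ih.2)).1
      have h' : Q (f (f^[k] p) - x) ≤ c * Q (f^[k] p - x) := h
      constructor
      · rw [pow_succ']
        nlinarith [ih.1]
      · nlinarith [ih.2, hQnn (f^[k] p - x)]
  refine ⟨fun k => (hball (hUr _ (hk k).2)).2, ?_⟩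
  rw [tendsto_iff_norm_sub_tendsto_zero]
  have h6 : Tendsto (fun k => ‖f^[k] p - x‖ ^ 2) atTop (𝓝 0) := by
    have hlim : Tendsto (fun k : ℕ => μ⁻¹ * (c ^ k * Q (p - x))) atTop (𝓝 0) := by
      have := ((tendsto_pow_atTop_nhds_zero_of_lt_one hc0.le hc1).mul_const (Q (p - x))).const_mul μ⁻¹
      simpa using this
    refine squeeze_zero (fun _ => by positivity) (fun k => ?_) hlim
    rw [← div_eq_inv_mul, le_div_iff₀ hμ0]
    linarith [hlow (f^[k] p - x), (hk k).1]
  have := h6.sqrt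
  simpa using this

lemma eig_bound {n : ℕ} (G B : Matrix (Fin n) (Fin n) ℝ) (hG : G.PosDef) (hB : B.IsHermitian)
    (hsr : spectralRadius ℂ ((G⁻¹ * (B - G)).map (algebraMap ℝ ℂ)) < 1) (x : Fin n → ℝ)
    (hx : x ≠ 0) : x ⬝ᵥ B *ᵥ x < 2 * (x ⬝ᵥ G *ᵥ x) := by
  have hGp : ∀ y : Fin n → ℝ, y ≠ 0 → 0 < y ⬝ᵥ G *ᵥ y := fun y hy => by
    simpa using hG.dotProduct_mulVec_pos hy
  have hne : ∀ y ∈ Metric.sphere (0 : Fin n → ℝ) 1, y ≠ 0 := by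
    intro y hy h; simp [h] at hy
  have hnx : 0 < ‖x‖ := norm_pos_iff.2 hx
  obtain ⟨y, hy, hmax⟩ := (isCompact_sphere (0 : Fin n → ℝ) 1).exists_isMaxOn
    ⟨‖x‖⁻¹ • x, by simp [norm_smul, hnx.ne']⟩
    (f := fun y => (y ⬝ᵥ B *ᵥ y) / (y ⬝ᵥ G *ᵥ y)) (by
      refine ContinuousOn.div (Continuous.continuousOn (by fun_prop)) (Continuous.continuousOn (by fun_prop)) ?_
      intro y hy; exact (hGp y (hne y hy)).ne')
  set l : ℝ := (y ⬝ᵥ B *ᵥ y) / (y ⬝ᵥ G *ᵥ y) with hl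
  have hy0 := hne y hy
  have hall : ∀ v : Fin n → ℝ, v ⬝ᵥ B *ᵥ v ≤ l * (v ⬝ᵥ G *ᵥ v) := by
    intro v
    by_cases hv : v = 0
    · simp [hv]
    have hnv : 0 < ‖v‖ := norm_pos_iff.2 hv
    have h := hmax (a := ‖v‖⁻¹ • v) (by simp [norm_smul, hnv.ne'])
    simp only [Set.mem_ofPred_eq, mulVec_smul, dotProduct_smul, smul_dotProduct, smul_eq_mul] at h
    rw [mul_div_mul_left _ _ (by positivity), mul_div_mul_left _ _ (by positivity), ← hl, div_le_iff₀ (hGp v hv)] at h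
    exact h
  have hpsd : (l • G - B).PosSemidef := by
    refine Matrix.PosSemidef.of_dotProduct_mulVec_nonneg ?_ ?_
    · exact (hG.1.smul (by simp [IsSelfAdjoint])).sub hB
    · intro v
      have := hall v
      simp [sub_mulVec, smul_mulVec, dotProduct_sub]
      linarith
  have hker : (l • G - B) *ᵥ y = 0 := by
    rw [← hpsd.dotProduct_mulVec_zero_iff]
    have h := hGp y hy0
    simp [sub_mulVec, smul_mulVec, dotProduct_sub, hl]
    field_simp; simp
  have hBy : B *ᵥ y = l • (G *ᵥ y) := by
    rw [sub_mulVec, smul_mulVec, sub_eq_zero] at hker; exact hker.symm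
  have hdet : IsUnit G.det := (Matrix.isUnit_iff_isUnit_det _).1 hG.isUnit
  have hMy : (G⁻¹ * (B - G)) *ᵥ y = (l - 1) • y := by
    rw [← mulVec_mulVec, sub_mulVec, hBy, mulVec_sub, mulVec_smul, mulVec_mulVec,
      nonsing_inv_mul _ hdet, one_mulVec, sub_smul, one_smul]
  have hspec : ((l - 1 : ℝ) : ℂ) ∈ spectrum ℂ ((G⁻¹ * (B - G)).map (algebraMap ℝ ℂ)) := by
    rw [← Matrix.spectrum_toLin']
    apply Module.End.HasEigenvalue.mem_spectrum
    apply Module.End.hasEigenvalue_of_hasEigenvector (x := fun i => (y i : ℂ))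
    rw [Module.End.hasEigenvector_iff, Module.End.mem_eigenspace_iff]
    constructor
    · rw [Matrix.toLin'_apply]
      ext i
      have := congrFun hMy i
      have h2 := congrArg (fun t : ℝ => (t : ℂ)) this
      simp only [mulVec, dotProduct, Pi.smul_apply, smul_eq_mul, Complex.ofReal_sum, Complex.ofReal_mul] at h2
      simpa [mulVec, dotProduct] using h2
    · intro h
      apply hy0
      ext i
      simpa using congrFun h i
  have hl1 : ‖((l - 1 : ℝ) : ℂ)‖₊ < (1 : ENNReal) :=
    (le_iSup₂ (f := fun (k : ℂ) (_ : k ∈ spectrum ℂ ((G⁻¹ * (B - G)).map (algebraMap ℝ ℂ))) => (‖k‖₊ : ENNReal)) _ hspec).trans_lt hsr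
  have hl2 : ‖((l - 1 : ℝ) : ℂ)‖ < 1 := by
    have : ‖((l - 1 : ℝ) : ℂ)‖₊ < 1 := by exact_mod_cast hl1
    exact_mod_cast this
  rw [Complex.norm_real, Real.norm_eq_abs, abs_lt] at hl2
  nlinarith [hall x, hGp x hx]

lemma inv_cont {n : ℕ} (M : Matrix (Fin n) (Fin n) ℝ) (h : M.det ≠ 0) :
    ContinuousAt (fun A : Matrix (Fin n) (Fin n) ℝ => A⁻¹) M := by
  have : (fun A : Matrix (Fin n) (Fin n) ℝ => A⁻¹) = fun A => (A.det)⁻¹ • A.adjugate := by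
    ext1 A; rw [Matrix.inv_def, Ring.inverse_eq_inv']
  rw [this]
  refine ContinuousAt.smul (ContinuousAt.inv₀ ?_ h) ?_
  · exact (continuous_id.matrix_det).continuousAt
  · exact (continuous_id.matrix_adjugate).continuousAt

lemma hasFDerivAt_mul_cont {P : Type*} [NormedAddCommGroup P] [NormedSpace ℝ P]
    (f g : P → ℝ) (g' : P →L[ℝ] ℝ) (x : P) (hf : ContinuousAt f x) (hg : HasFDerivAt g g' x)
    (hg0 : g x = 0) : HasFDerivAt (fun p => f p * g p) (f x • g') x := by
  rw [hasFDerivAt_iff_isLittleO]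
  have h1 : (fun p => f p * (g p - g x - g' (p - x))) =o[𝓝 x] fun p => (1 : ℝ) * ‖p - x‖ := 
    (hf.tendsto.isBigO_one ℝ).mul_isLittleO hg.isLittleO.norm_right
  have h2 : (fun p => (f p - f x) * g' (p - x)) =o[𝓝 x] fun p => (1 : ℝ) * ‖p - x‖ := by
    refine Asymptotics.IsLittleO.mul_isBigO ?_ ?_
    · rw [Asymptotics.isLittleO_one_iff]
      simpa using hf.tendsto.sub_const (f x)
    · exact (g'.isBigO_sub (𝓝 x) x).norm_right
  have h3 := h1.add h2
  simp only [one_mul] at h3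
  rw [Asymptotics.isLittleO_norm_right] at h3
  refine h3.congr_left fun p => ?_
  simp [hg0]; ring

lemma hasFDerivAt_mulVec_cont {P : Type*} [NormedAddCommGroup P] [NormedSpace ℝ P] {n : ℕ}
    (M : P → Matrix (Fin n) (Fin n) ℝ) (g : P → Fin n → ℝ) (g' : P →L[ℝ] (Fin n → ℝ)) (x : P)
    (hM : ContinuousAt M x) (hg : HasFDerivAt g g' x) (hg0 : g x = 0) :
    HasFDerivAt (fun p => M p *ᵥ g p) ((Matrix.mulVecLin (M x)).toContinuousLinearMap ∘L g') x := by
  rw [hasFDerivAt_pi']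
  intro i
  have h : ∀ j ∈ Finset.univ, HasFDerivAt (fun p => M p i j * g p j)
      (M x i j • ((ContinuousLinearMap.proj (R := ℝ) j).comp g')) x := fun j _ => by
    apply hasFDerivAt_mul_cont (fun p => M p i j) (fun p => g p j)
    · exact ((continuous_apply j).comp (continuous_apply i)).continuousAt.comp hM
    · exact (hasFDerivAt_pi'.1 hg) j
    · simp [hg0]
  refine (HasFDerivAt.fun_sum h).congr_fderiv ?_
  ext p
  simp [mulVec, dotProduct]

lemma pd_eq {ι : Type*} [Fintype ι] [DecidableEq ι] (f : (ι → ℝ) → ℝ) (x : ι → ℝ) (j : ι)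
    (hf : DifferentiableAt ℝ f x) : pd f x j = fderiv ℝ f x (Pi.single j 1) := by
  unfold pd
  have h : HasFDerivAt f (fderiv ℝ f x) (Function.update x j (x j)) := by
    simpa using hf.hasFDerivAt
  exact (h.comp_hasDerivAt (x j) (hasDerivAt_update x j (x j))).deriv

lemma w_eq (i : Fin m) (j : Fin n) (ρ z : Fin n → ℝ) :
    w φ ζ I i j ρ z = deriv φ (res ζ I i j ρ z) / res ζ I i j ρ z := by
  unfold w; split_ifs with h <;> simp [h]

lemma fullE_contDiff (hC2 : ContDiff ℝ 2 φ) (hζ : ∀ i j, ContDiff ℝ 2 (ζ i j)) :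
    ContDiff ℝ 2 (fullE φ ζ I) := by
  unfold fullE E res
  refine ContDiff.sum fun i _ => ContDiff.sum fun j _ => hC2.comp ?_
  refine ContDiff.sub (ContDiff.mul ?_ ((hζ i j).comp ?_)) contDiff_const
  · exact contDiff_apply ℝ ℝ (Sum.inl j)
  · exact contDiff_pi.2 fun l => contDiff_apply ℝ ℝ (Sum.inr l)

lemma gradρE_eq (ρ z : Fin n → ℝ) (j : Fin n) :
    gradρE φ ζ I ρ z j = pd (fullE φ ζ I) (Sum.elim ρ z) (Sum.inl j) := by
  simp only [gradρE, pd, fullE, Sum.update_elim_inl, Sum.elim_comp_inl, Sum.elim_comp_inr, Sum.elim_inl]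

lemma gradzE_eq (ρ z : Fin n → ℝ) (j : Fin n) :
    gradzE φ ζ I ρ z j = pd (fullE φ ζ I) (Sum.elim ρ z) (Sum.inr j) := by
  simp only [gradzE, pd, fullE, Sum.update_elim_inr, Sum.elim_comp_inl, Sum.elim_comp_inr, Sum.elim_inr]

lemma hesszz_eq (ρ z : Fin n → ℝ) :
    hesszzE φ ζ I ρ z = (fullHess φ ζ I ρ z).toBlocks₂₂ := by
  ext j l
  simp only [hesszzE, toBlocks₂₂, fullHess, of_apply]
  simp only [gradzE_eq]
  simp only [pd, Sum.update_elim_inr, Sum.elim_inr]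

lemma pd_fullE_inl (hC2 : ContDiff ℝ 2 φ) (x : Fin n ⊕ Fin n → ℝ) (j : Fin n) :
    pd (fullE φ ζ I) x (Sum.inl j) = ∑ i, deriv φ (x (Sum.inl j) * ζ i j (x ∘ Sum.inr) - I i j) *
      ζ i j (x ∘ Sum.inr) := by
  unfold pd
  refine HasDerivAt.deriv ?_
  unfold fullE E res
  have hz : ∀ t, Function.update x (Sum.inl j) t ∘ Sum.inr = x ∘ Sum.inr := by
    intro t; ext l; simp
  simp only [hz]
  refine HasDerivAt.fun_sum fun i _ => ?_
  have : deriv φ (x (Sum.inl j) * ζ i j (x ∘ Sum.inr) - I i j) * ζ i j (x ∘ Sum.inr)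
    = ∑ k, if k = j then deriv φ (x (Sum.inl j) * ζ i j (x ∘ Sum.inr) - I i j) * ζ i j (x ∘ Sum.inr) else 0 := by simp
  rw [this]
  refine HasDerivAt.fun_sum fun k _ => ?_
  by_cases h : k = j
  · subst h
    simp only [Function.comp, Function.update_self, if_true]
    have hd : HasDerivAt φ (deriv φ (x (Sum.inl k) * ζ i k (x ∘ Sum.inr) - I i k)) (x (Sum.inl k) * ζ i k (x ∘ Sum.inr) - I i k) :=
      (hC2.differentiable (by norm_num)).differentiableAt.hasDerivAt
    exact hd.comp (x (Sum.inl k)) (by simpa using ((hasDerivAt_id (x (Sum.inl k))).mul_const (ζ i k (x ∘ Sum.inr))).sub_const (I i k))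
  · simp [h, Function.update_apply]
    exact hasDerivAt_const _ _

lemma hess_inl (hC2 : ContDiff ℝ 2 φ) (ρ z : Fin n → ℝ) :
    (fullHess φ ζ I ρ z).toBlocks₁₁ = Matrix.diagonal fun j =>
      ∑ i, deriv (deriv φ) (res ζ I i j ρ z) * ζ i j z ^ 2 := by
  ext k j
  simp only [toBlocks₁₁, fullHess, of_apply, pd_fullE_inl φ ζ I hC2]
  unfold pd
  have hz : ∀ t, Function.update (Sum.elim ρ z) (Sum.inl k) t ∘ Sum.inr = z := by
    intro t; rw [Sum.update_elim_inl, Sum.elim_comp_inr]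
  simp only [hz]
  refine HasDerivAt.deriv ?_
  by_cases h : k = j
  · subst h
    simp only [Function.update_self, diagonal_apply_eq]
    refine HasDerivAt.fun_sum fun i _ => ?_
    have hd : HasDerivAt (deriv φ) (deriv (deriv φ) (res ζ I i k ρ z)) (res ζ I i k ρ z) := by
      refine DifferentiableAt.hasDerivAt ?_
      have : ContDiff ℝ 1 (deriv φ) := (contDiff_succ_iff_deriv (n := 1) (𝕜 := ℝ)).1 (by simpa [one_add_one_eq_two] using hC2) |>.2.2
      exact (this.differentiable (by norm_num)).differentiableAt
    have := (hd.comp (ρ k) (h := fun t => t * ζ i k z - I i k) (by simpa using ((hasDerivAt_id (ρ k)).mul_const (ζ i k z)).sub_const (I i k))).mul_const (ζ i k z)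
    rw [pow_two, ← mul_assoc]
    exact this
  · have h' : ¬ j = k := fun e => h e.symm
    simp [h, h', Function.update_apply]
    exact hasDerivAt_const _ _

lemma hasFDerivAt_pd {ι : Type*} [Fintype ι] [DecidableEq ι] (f : (ι → ℝ) → ℝ) (hf : ContDiff ℝ 2 f)
    (x : ι → ℝ) (b : ι) : HasFDerivAt (fun x => pd f x b)
      (∑ a, pd (fun x => pd f x b) x a • ContinuousLinearMap.proj (R := ℝ) (φ := fun _ : ι => ℝ) a) x := by
  have h1 : (fun x => pd f x b) = fun x => fderiv ℝ f x (Pi.single b 1) := by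
    ext x; exact pd_eq f x b (hf.differentiable (by norm_num)).differentiableAt
  have h2 : ContDiff ℝ 1 (fun x => pd f x b) := by
    rw [h1]
    exact (hf.fderiv_right (m := 1) (by norm_num [one_add_one_eq_two])).clm_apply contDiff_const
  have h3 : DifferentiableAt ℝ (fun x => pd f x b) x := (h2.differentiable (by norm_num)).differentiableAt
  refine h3.hasFDerivAt.congr_fderiv ?_
  ext v
  simp only [pd_eq (fun x => pd f x b) x _ h3]
  conv_lhs => rw [pi_eq_sum_univ' v]
  simp [map_sum, mul_comm]

lemma grad_cont {ι : Type*} [Fintype ι] [DecidableEq ι] (f : (ι → ℝ) → ℝ) (hf : ContDiff ℝ 2 f)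
    (l : ι) : Continuous fun x => pd f x l :=
  continuous_iff_continuousAt.2 fun x => (hasFDerivAt_pd f hf x l).continuousAt

lemma res_cont (hζ : ∀ i j, ContDiff ℝ 2 (ζ i j)) (i : Fin m) (j : Fin n) :
    Continuous fun p : (Fin n → ℝ) × (Fin n → ℝ) => res ζ I i j p.1 p.2 := by
  unfold res
  have := (hζ i j).continuous
  fun_prop

lemma w_cont (hC2 : ContDiff ℝ 2 φ) (hζ : ∀ i j, ContDiff ℝ 2 (ζ i j)) (ρs zs : Fin n → ℝ)
    (hr0 : ∀ i j, res ζ I i j ρs zs ≠ 0) (i : Fin m) (j : Fin n) :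
    ContinuousAt (fun p : (Fin n → ℝ) × (Fin n → ℝ) => w φ ζ I i j p.1 p.2) (ρs, zs) := by
  simp only [w_eq]
  have h := res_cont ζ I hζ i j
  have hd : Continuous (deriv φ) := hC2.continuous_deriv (by norm_num)
  exact ((hd.comp h).continuousAt).div h.continuousAt (hr0 i j)

lemma Hρ_cont (hC2 : ContDiff ℝ 2 φ) (hζ : ∀ i j, ContDiff ℝ 2 (ζ i j)) (ρs zs : Fin n → ℝ)
    (hr0 : ∀ i j, res ζ I i j ρs zs ≠ 0) :
    ContinuousAt (fun p : (Fin n → ℝ) × (Fin n → ℝ) => Hρ φ ζ I p.1 p.2) (ρs, zs) := by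
  unfold Hρ
  have hc : Continuous (fun d : Fin n → ℝ => Matrix.diagonal d) := continuous_id.matrix_diagonal
  refine hc.continuousAt.comp (f := fun p : (Fin n → ℝ) × (Fin n → ℝ) => fun j => ∑ i, w φ ζ I i j p.1 p.2 * (ζ i j p.2) ^ 2) ?_
  refine continuousAt_pi.2 fun j => ?_
  refine tendsto_finsetSum _ fun i _ => ?_
  refine (w_cont φ ζ I hC2 hζ ρs zs hr0 i j).mul (Continuous.continuousAt ?_)
  have := (hζ i j).continuous
  fun_prop

lemma Hz_cont (hC2 : ContDiff ℝ 2 φ) (hζ : ∀ i j, ContDiff ℝ 2 (ζ i j)) (ρs zs : Fin n → ℝ)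
    (hr0 : ∀ i j, res ζ I i j ρs zs ≠ 0) :
    ContinuousAt (fun p : (Fin n → ℝ) × (Fin n → ℝ) => Hz φ ζ I p.1 p.2) (ρs, zs) := by
  unfold Hz
  refine tendsto_finsetSum _ fun i _ => tendsto_finsetSum _ fun j _ => ?_
  refine ContinuousAt.smul (f := fun p : (Fin n → ℝ) × (Fin n → ℝ) => w φ ζ I i j p.1 p.2 * (p.1 j) ^ 2)
    (g := fun p : (Fin n → ℝ) × (Fin n → ℝ) => vecMulVec (gradζ ζ i j p.2) (gradζ ζ i j p.2)) ?_ ?_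
  · refine (w_cont φ ζ I hC2 hζ ρs zs hr0 i j).mul (Continuous.continuousAt ?_)
    fun_prop
  · have hg : Continuous (gradζ ζ i j) := continuous_pi fun l => grad_cont _ (hζ i j) l
    refine Continuous.continuousAt ?_
    exact (hg.comp continuous_snd).matrix_vecMulVec (hg.comp continuous_snd)

lemma half_step {ι : Type*} [Fintype ι] (H : Matrix ι ι ℝ) (hH : H.IsHermitian)
    (x d : ι → ℝ) : (x - d) ⬝ᵥ H *ᵥ (x - d) = x ⬝ᵥ H *ᵥ x - 2 * (d ⬝ᵥ H *ᵥ x) + d ⬝ᵥ H *ᵥ d := by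
  have h : x ⬝ᵥ H *ᵥ d = d ⬝ᵥ H *ᵥ x := by
    rw [dotProduct_mulVec, dotProduct_comm, ← mulVec_transpose]
    have : Hᵀ = H := by rw [IsHermitian, conjTranspose_eq_transpose_of_trivial] at hH; exact hH
    rw [this]
  simp only [mulVec_sub, dotProduct_sub, sub_dotProduct, h]
  ring

lemma lin_decr (H : Matrix (Fin n ⊕ Fin n) (Fin n ⊕ Fin n) ℝ) (hH : H.PosDef)
    (R Z : Matrix (Fin n) (Fin n) ℝ) (hRu : IsUnit R.det) (hZu : IsUnit Z.det)
    (hR : ∀ u : Fin n → ℝ, u ≠ 0 → u ⬝ᵥ H.toBlocks₁₁ *ᵥ u < 2 * (u ⬝ᵥ R *ᵥ u))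
    (hZ : ∀ u : Fin n → ℝ, u ≠ 0 → u ⬝ᵥ H.toBlocks₂₂ *ᵥ u < 2 * (u ⬝ᵥ Z *ᵥ u))
    (x y u : Fin n → ℝ) (hne : (x, y) ≠ 0)
    (hu : u = x - R⁻¹ *ᵥ ((H *ᵥ Sum.elim x y) ∘ Sum.inl)) (v : Fin n → ℝ)
    (hv : v = y - Z⁻¹ *ᵥ ((H *ᵥ Sum.elim u y) ∘ Sum.inr)) :
    Sum.elim u v ⬝ᵥ H *ᵥ Sum.elim u v < Sum.elim x y ⬝ᵥ H *ᵥ Sum.elim x y := by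
  set d := R⁻¹ *ᵥ ((H *ᵥ Sum.elim x y) ∘ Sum.inl) with hd
  set e := Z⁻¹ *ᵥ ((H *ᵥ Sum.elim u y) ∘ Sum.inr) with he
  have hRd : R *ᵥ d = (H *ᵥ Sum.elim x y) ∘ Sum.inl := by
    rw [hd, mulVec_mulVec, mul_nonsing_inv _ hRu, one_mulVec]
  have hZe : Z *ᵥ e = (H *ᵥ Sum.elim u y) ∘ Sum.inr := by
    rw [he, mulVec_mulVec, mul_nonsing_inv _ hZu, one_mulVec]
  have e1 : (Sum.elim u y : Fin n ⊕ Fin n → ℝ) = Sum.elim x y - Sum.elim d (0 : Fin n → ℝ) := by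
    ext a; cases a <;> simp [hu]
  have e2 : (Sum.elim u v : Fin n ⊕ Fin n → ℝ) = Sum.elim u y - Sum.elim (0 : Fin n → ℝ) e := by
    ext a; cases a <;> simp [hv]
  have s1 := half_step H hH.1 (Sum.elim x y) (Sum.elim d (0 : Fin n → ℝ))
  have s2 := half_step H hH.1 (Sum.elim u y) (Sum.elim (0 : Fin n → ℝ) e)
  rw [← e1] at s1
  rw [← e2] at s2
  have t1 : Sum.elim d (0 : Fin n → ℝ) ⬝ᵥ H *ᵥ Sum.elim x y = d ⬝ᵥ R *ᵥ d := by
    rw [hRd]; simp [dotProduct]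
  have t2 : Sum.elim (0 : Fin n → ℝ) e ⬝ᵥ H *ᵥ Sum.elim u y = e ⬝ᵥ Z *ᵥ e := by
    rw [hZe]; simp [dotProduct]
  have t3 : Sum.elim d (0 : Fin n → ℝ) ⬝ᵥ H *ᵥ Sum.elim d (0 : Fin n → ℝ) = d ⬝ᵥ H.toBlocks₁₁ *ᵥ d := by
    simp [dotProduct, mulVec, toBlocks₁₁]
  have t4 : Sum.elim (0 : Fin n → ℝ) e ⬝ᵥ H *ᵥ Sum.elim (0 : Fin n → ℝ) e = e ⬝ᵥ H.toBlocks₂₂ *ᵥ e := by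
    simp [dotProduct, mulVec, toBlocks₂₂]
  rw [t1, t3] at s1
  rw [t2, t4] at s2
  by_cases hd0 : d = 0
  · by_cases he0 : e = 0
    · exfalso
      have hux : u = x := by rw [hu, hd0, sub_zero]
      rw [hd0, mulVec_zero] at hRd
      rw [he0, mulVec_zero, hux] at hZe
      have h0 : H *ᵥ Sum.elim x y = 0 := by
        ext a; cases a with
        | inl a => exact (congrFun hRd a).symm
        | inr a => exact (congrFun hZe a).symm
      have hxy : Sum.elim x y ≠ 0 := by
        intro h
        apply hne
        ext a
        · exact congrFun h (Sum.inl a)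
        · exact congrFun h (Sum.inr a)
      have := hH.dotProduct_mulVec_pos hxy
      simp [h0] at this
    · have := hZ e he0
      simp [hd0] at s1
      linarith
  · have h1 := hR d hd0
    by_cases he0 : e = 0
    · simp [he0] at s2
      linarith
    · have := hZ e he0
      linarith

noncomputable def elimCLM (n : ℕ) :
    ((Fin n → ℝ) × (Fin n → ℝ)) →L[ℝ] (Fin n ⊕ Fin n → ℝ) :=
  LinearMap.toContinuousLinearMap
    { toFun := fun p => Sum.elim p.1 p.2
      map_add' := by intro p q; ext a; cases a <;> simp
      map_smul' := by intro c p; ext a; cases a <;> simp }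

lemma elimCLM_apply (p : (Fin n → ℝ) × (Fin n → ℝ)) : elimCLM n p = Sum.elim p.1 p.2 := rfl

noncomputable def gCLM (H : Matrix (Fin n ⊕ Fin n) (Fin n ⊕ Fin n) ℝ) (s : Fin n → Fin n ⊕ Fin n) :
    ((Fin n → ℝ) × (Fin n → ℝ)) →L[ℝ] (Fin n → ℝ) :=
  (LinearMap.toContinuousLinearMap (LinearMap.funLeft ℝ ℝ s ∘ₗ H.mulVecLin)) ∘L elimCLM n

lemma gCLM_apply (H : Matrix (Fin n ⊕ Fin n) (Fin n ⊕ Fin n) ℝ) (s : Fin n → Fin n ⊕ Fin n)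
    (p : (Fin n → ℝ) × (Fin n → ℝ)) : gCLM H s p = (H *ᵥ Sum.elim p.1 p.2) ∘ s := rfl

lemma grad_deriv (hC2 : ContDiff ℝ 2 φ) (hζ : ∀ i j, ContDiff ℝ 2 (ζ i j)) (ρs zs : Fin n → ℝ)
    (hH : (fullHess φ ζ I ρs zs).IsHermitian) (s : Fin n → Fin n ⊕ Fin n) :
    HasFDerivAt (fun (p : (Fin n → ℝ) × (Fin n → ℝ)) (j : Fin n) =>
      pd (fullE φ ζ I) (Sum.elim p.1 p.2) (s j)) (gCLM (fullHess φ ζ I ρs zs) s) (ρs, zs) := by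
  rw [hasFDerivAt_pi']
  intro j
  have h1 := hasFDerivAt_pd (fullE φ ζ I) (fullE_contDiff φ ζ I hC2 hζ) (elimCLM n (ρs, zs)) (s j)
  have h2 := h1.comp (ρs, zs) (elimCLM n).hasFDerivAt
  refine h2.congr_fderiv ?_
  refine ContinuousLinearMap.ext fun p => ?_
  simp only [ContinuousLinearMap.comp_apply, ContinuousLinearMap.proj_apply, gCLM_apply,
    Function.comp, elimCLM_apply, ContinuousLinearMap.sum_apply, ContinuousLinearMap.smul_apply, smul_eq_mul,
    mulVec, dotProduct]
  refine Finset.sum_congr rfl fun a _ => ?_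
  have := hH.apply (s j) a
  simp only [star_trivial] at this
  rw [← this]
  rfl

lemma isUnit_det_of_pos (M : Matrix (Fin n) (Fin n) ℝ)
    (h : ∀ u : Fin n → ℝ, u ≠ 0 → 0 < u ⬝ᵥ M *ᵥ u) : IsUnit M.det := by
  rw [isUnit_iff_ne_zero]
  intro h0
  obtain ⟨v, hv, hv0⟩ := Matrix.exists_mulVec_eq_zero_iff.2 h0
  have := h v hv
  simp [hv0] at this

lemma quad_sum (c : Fin m → Fin n → ℝ) (g : Fin m → Fin n → Fin n → ℝ) (u : Fin n → ℝ) :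
    u ⬝ᵥ (∑ i, ∑ j, c i j • vecMulVec (g i j) (g i j)) *ᵥ u = ∑ i, ∑ j, c i j * (g i j ⬝ᵥ u) ^ 2 := by
  simp only [sum_mulVec, dotProduct_sum, smul_mulVec, dotProduct_smul, vecMulVec_mulVec, smul_eq_mul]
  refine Finset.sum_congr rfl fun i _ => Finset.sum_congr rfl fun j _ => ?_
  simp [dotProduct_comm u, pow_two]

/-- **Theorem 1 (local convergence of ARLS).**
Under the stated conditions (i)–(v) at a local minimizer `(ρ*,z*)`, there is a
neighborhood `U` of `(ρ*,z*)` such that, from any starting point in `U`, the ARLS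
iterates are well defined (the surrogate Hessians are invertible along the iterates)
and converge to `(ρ*,z*)`. -/
theorem arls_local_convergence
    (hm : 1 ≤ m) (hn : 1 ≤ n)
    (hEven : ∀ x : ℝ, φ (-x) = φ x)
    (hC2 : ContDiff ℝ 2 φ)
    (hMono : MonotoneOn φ (Set.Ici (0 : ℝ)))
    (hAdm : ∀ x : ℝ, x ≠ 0 → deriv (deriv φ) x ≤ deriv φ x / x)
    (hζ : ∀ i j, ContDiff ℝ 2 (ζ i j))
    (ρs zs : Fin n → ℝ)
    -- (i) all shadings and residuals are nonzero at the minimizer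
    (hζ0 : ∀ i j, ζ i j zs ≠ 0)
    (hr0 : ∀ i j, res ζ I i j ρs zs ≠ 0)
    -- (ii) first-order optimality
    (hgρ : gradρE φ ζ I ρs zs = 0)
    (hgz : gradzE φ ζ I ρs zs = 0)
    -- (iii) second-order sufficient optimality
    (hfull : (fullHess φ ζ I ρs zs).PosDef)
    -- (iv) positive definite Gauss–Newton Hessian
    (hG : (G φ ζ I ρs zs).PosDef)
    -- (v) spectral radius condition
    (hsr : spectralRadius ℂ
        (((G φ ζ I ρs zs)⁻¹ * (hesszzE φ ζ I ρs zs - G φ ζ I ρs zs)).map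
          (algebraMap ℝ ℂ)) < 1) :
    ∃ U ∈ 𝓝 ((ρs, zs) : (Fin n → ℝ) × (Fin n → ℝ)), ∀ p₀ ∈ U,
      (∀ k : ℕ,
        IsUnit (Hρ φ ζ I ((step φ ζ I)^[k] p₀).1 ((step φ ζ I)^[k] p₀).2).det ∧
        IsUnit (Hz φ ζ I (stepρ φ ζ I ((step φ ζ I)^[k] p₀)) ((step φ ζ I)^[k] p₀).2).det)
      ∧ Tendsto (fun k => (step φ ζ I)^[k] p₀) atTop (𝓝 (ρs, zs)) := by
  have hres : ∀ i j, deriv (deriv φ) (res ζ I i j ρs zs) ≤ w φ ζ I i j ρs zs := by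
    intro i j; rw [w_eq]; exact hAdm _ (hr0 i j)
  set H := fullHess φ ζ I ρs zs with hHdef
  have hA : ∀ u : Fin n → ℝ, u ≠ 0 → 0 < u ⬝ᵥ H.toBlocks₁₁ *ᵥ u := by
    intro u hu
    have hne : Sum.elim u (0 : Fin n → ℝ) ≠ 0 := by
      intro h; apply hu; ext a; exact congrFun h (Sum.inl a)
    have h := hfull.dotProduct_mulVec_pos hne
    have t3 : Sum.elim u (0 : Fin n → ℝ) ⬝ᵥ H *ᵥ Sum.elim u (0 : Fin n → ℝ) = u ⬝ᵥ H.toBlocks₁₁ *ᵥ u := by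
      simp [dotProduct, mulVec, toBlocks₁₁]
    rw [star_trivial, t3] at h
    exact h
  have hAR : ∀ u : Fin n → ℝ, u ⬝ᵥ H.toBlocks₁₁ *ᵥ u ≤ u ⬝ᵥ Hρ φ ζ I ρs zs *ᵥ u := by
    intro u
    rw [hHdef, hess_inl φ ζ I hC2, Hρ]
    simp only [dotProduct, mulVec_diagonal]
    refine Finset.sum_le_sum fun j _ => ?_
    have : ∑ i, deriv (deriv φ) (res ζ I i j ρs zs) * ζ i j zs ^ 2 ≤
        ∑ i, w φ ζ I i j ρs zs * ζ i j zs ^ 2 :=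
      Finset.sum_le_sum fun i _ => mul_le_mul_of_nonneg_right (hres i j) (sq_nonneg _)
    nlinarith [sq_nonneg (u j)]
  have hGZ : ∀ u : Fin n → ℝ, u ⬝ᵥ G φ ζ I ρs zs *ᵥ u ≤ u ⬝ᵥ Hz φ ζ I ρs zs *ᵥ u := by
    intro u
    rw [G, Hz, quad_sum, quad_sum]
    refine Finset.sum_le_sum fun i _ => Finset.sum_le_sum fun j _ => ?_
    exact mul_le_mul_of_nonneg_right (mul_le_mul_of_nonneg_right (hres i j) (sq_nonneg _)) (sq_nonneg _)
  have hGp : ∀ u : Fin n → ℝ, u ≠ 0 → 0 < u ⬝ᵥ G φ ζ I ρs zs *ᵥ u := fun u hu => by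
    simpa using hG.dotProduct_mulVec_pos hu
  have hRu : IsUnit (Hρ φ ζ I ρs zs).det :=
    isUnit_det_of_pos _ fun u hu => (hA u hu).trans_le (hAR u)
  have hZu : IsUnit (Hz φ ζ I ρs zs).det :=
    isUnit_det_of_pos _ fun u hu => (hGp u hu).trans_le (hGZ u)
  have hR : ∀ u : Fin n → ℝ, u ≠ 0 → u ⬝ᵥ H.toBlocks₁₁ *ᵥ u < 2 * (u ⬝ᵥ Hρ φ ζ I ρs zs *ᵥ u) := by
    intro u hu
    linarith [hA u hu, hAR u]
  rw [hesszz_eq, ← hHdef] at hsr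
  have hBh : H.toBlocks₂₂.IsHermitian := hfull.1.submatrix Sum.inr
  have hZ : ∀ u : Fin n → ℝ, u ≠ 0 → u ⬝ᵥ H.toBlocks₂₂ *ᵥ u < 2 * (u ⬝ᵥ Hz φ ζ I ρs zs *ᵥ u) := by
    intro u hu
    have := eig_bound _ _ hG hBh hsr u hu
    linarith [hGZ u]
  -- derivatives
  have hRc := Hρ_cont φ ζ I hC2 hζ ρs zs hr0
  have hZc := Hz_cont φ ζ I hC2 hζ ρs zs hr0
  have hRic : ContinuousAt (fun p : (Fin n → ℝ) × (Fin n → ℝ) => (Hρ φ ζ I p.1 p.2)⁻¹) (ρs, zs) :=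
    ContinuousAt.comp (f := fun p : (Fin n → ℝ) × (Fin n → ℝ) => Hρ φ ζ I p.1 p.2)
      (inv_cont _ hRu.ne_zero) hRc
  have hZic : ContinuousAt (fun p : (Fin n → ℝ) × (Fin n → ℝ) => (Hz φ ζ I p.1 p.2)⁻¹) (ρs, zs) :=
    ContinuousAt.comp (f := fun p : (Fin n → ℝ) × (Fin n → ℝ) => Hz φ ζ I p.1 p.2)
      (inv_cont _ hZu.ne_zero) hZc
  have hgρd : HasFDerivAt (fun p : (Fin n → ℝ) × (Fin n → ℝ) => gradρE φ ζ I p.1 p.2)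
      (gCLM H Sum.inl) (ρs, zs) := by
    have h := grad_deriv φ ζ I hC2 hζ ρs zs hfull.1 Sum.inl
    have e : (fun p : (Fin n → ℝ) × (Fin n → ℝ) => gradρE φ ζ I p.1 p.2) =
      fun p j => pd (fullE φ ζ I) (Sum.elim p.1 p.2) (Sum.inl j) := by
      funext p j; exact gradρE_eq φ ζ I p.1 p.2 j
    rw [e]; exact h
  have hgzd : HasFDerivAt (fun p : (Fin n → ℝ) × (Fin n → ℝ) => gradzE φ ζ I p.1 p.2)
      (gCLM H Sum.inr) (ρs, zs) := by
    have h := grad_deriv φ ζ I hC2 hζ ρs zs hfull.1 Sum.inr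
    have e : (fun p : (Fin n → ℝ) × (Fin n → ℝ) => gradzE φ ζ I p.1 p.2) =
      fun p j => pd (fullE φ ζ I) (Sum.elim p.1 p.2) (Sum.inr j) := by
      funext p j; exact gradzE_eq φ ζ I p.1 p.2 j
    rw [e]; exact h
  have hσ1 := hasFDerivAt_fst.sub (hasFDerivAt_mulVec_cont _ _ _ _ hRic hgρd hgρ)
  have hσ1' : HasFDerivAt (stepρ φ ζ I) _ (ρs, zs) := hσ1
  have hσ := hσ1'.prodMk (hasFDerivAt_snd (𝕜 := ℝ) (p := ((ρs, zs) : (Fin n → ℝ) × (Fin n → ℝ))))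
  have hfix : stepρ φ ζ I (ρs, zs) = ρs := by
    simp only [stepρ, hgρ, mulVec_zero, sub_zero]
  have hfix2 : step φ ζ I (ρs, zs) = (ρs, zs) := by
    simp only [step, hfix, hgz, mulVec_zero, sub_zero]
  have hτ := hasFDerivAt_snd.sub (hasFDerivAt_mulVec_cont _ _ _ _ hZic hgzd hgz)
  have hτ' := HasFDerivAt.comp (f := fun p : (Fin n → ℝ) × (Fin n → ℝ) => (stepρ φ ζ I p, p.2))
    (ρs, zs) (by simp only [hfix]; exact hτ) hσ
  have hstep := hσ1'.prodMk hτ'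
  have hWd : {p : (Fin n → ℝ) × (Fin n → ℝ) | IsUnit (Hρ φ ζ I p.1 p.2).det ∧
      IsUnit (Hz φ ζ I (stepρ φ ζ I p) p.2).det} ∈ 𝓝 ((ρs, zs) : (Fin n → ℝ) × (Fin n → ℝ)) := by
    have hdc : Continuous fun M : Matrix (Fin n) (Fin n) ℝ => M.det := continuous_id.matrix_det
    have h1 : ContinuousAt (fun p : (Fin n → ℝ) × (Fin n → ℝ) => (Hρ φ ζ I p.1 p.2).det) (ρs, zs) :=
      ContinuousAt.comp (f := fun p : (Fin n → ℝ) × (Fin n → ℝ) => Hρ φ ζ I p.1 p.2)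
        hdc.continuousAt hRc
    have h2 : ContinuousAt (fun p : (Fin n → ℝ) × (Fin n → ℝ) => (Hz φ ζ I p.1 p.2).det) (ρs, zs) :=
      ContinuousAt.comp (f := fun p : (Fin n → ℝ) × (Fin n → ℝ) => Hz φ ζ I p.1 p.2)
        hdc.continuousAt hZc
    have h3 : ContinuousAt (fun p : (Fin n → ℝ) × (Fin n → ℝ) =>
        (Hz φ ζ I (stepρ φ ζ I p) p.2).det) (ρs, zs) :=
      ContinuousAt.comp (f := fun p : (Fin n → ℝ) × (Fin n → ℝ) => (stepρ φ ζ I p, p.2))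
        (g := fun p : (Fin n → ℝ) × (Fin n → ℝ) => (Hz φ ζ I p.1 p.2).det)
        (by simp only [hfix]; exact h2) hσ.continuousAt
    have e1 := h1.eventually_ne hRu.ne_zero
    have e2 := h3.eventually_ne (by simp only [hfix]; exact hZu.ne_zero)
    filter_upwards [e1, e2] with p hp1 hp2
    exact ⟨isUnit_iff_ne_zero.2 hp1, isUnit_iff_ne_zero.2 hp2⟩
  have key := local_conv (step φ ζ I) _ (ρs, zs) hstep hfix2
    (fun p => Sum.elim p.1 p.2 ⬝ᵥ H *ᵥ Sum.elim p.1 p.2) ?_ ?_ ?_ ?_ _ hWd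
  · exact key
  · have hc : Continuous fun p : (Fin n → ℝ) × (Fin n → ℝ) => elimCLM n p := (elimCLM n).continuous
    exact hc.dotProduct (continuous_const.matrix_mulVec hc)
  · intro c p
    have : (Sum.elim (c • p).1 (c • p).2 : Fin n ⊕ Fin n → ℝ) = c • Sum.elim p.1 p.2 :=
      (elimCLM n).map_smul c p
    simp only [this, mulVec_smul, dotProduct_smul, smul_dotProduct, smul_eq_mul]
    ring
  · intro p hp
    have hne : Sum.elim p.1 p.2 ≠ 0 := by
      intro h
      apply hp
      ext a
      · exact congrFun h (Sum.inl a)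
      · exact congrFun h (Sum.inr a)
    have := hfull.dotProduct_mulVec_pos hne
    rwa [star_trivial] at this
  · intro p hp
    exact lin_decr H hfull _ _ hRu hZu hR hZ p.1 p.2 _ hp rfl _ rfl

end ARLS
end

section
/- Let φ : ℝ → ℝ be even, twice continuously differentiable, and satisfy φ'(x)/x ≥ φ''(x) for all x ≠ 0. Then for every r ≠ 0 and every s ∈ ℝ, φ(s) ≤ φ(r) + (φ'(r)/(2r)) (s² − r²). In other words, the reweighted quadratic model s ↦ φ(r) + (φ'(r)/r)(s² − r²)/2 is a majorant of φ which touches φ at s = r. -/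
theorem majorant_pos
    (φ : ℝ → ℝ)
    (hC2 : ContDiff ℝ 2 φ)
    (hAdm : ∀ x : ℝ, x ≠ 0 → deriv (deriv φ) x ≤ deriv φ x / x)
    (r : ℝ) (hr : 0 < r) (s : ℝ) (hs : 0 ≤ s) :
    φ s ≤ φ r + (deriv φ r / (2 * r)) * (s ^ 2 - r ^ 2) := by
  have hd : Differentiable ℝ φ := hC2.differentiable (by norm_num)
  have hC1 : ContDiff ℝ 1 (deriv φ) := by
    have h2 : ContDiff ℝ (1 + 1) φ := by
      convert hC2 using 1; norm_num
    exact (contDiff_succ_iff_deriv.1 h2).2.2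
  have hdd : Differentiable ℝ (deriv φ) := hC1.differentiable (by norm_num)
  have hgd : ∀ x : ℝ, x ≠ 0 → HasDerivAt (fun x => deriv φ x / x)
      ((deriv (deriv φ) x * x - deriv φ x * 1) / x ^ 2) x := fun x hx =>
    (hdd x).hasDerivAt.div (hasDerivAt_id x) hx
  have hg : AntitoneOn (fun x => deriv φ x / x) (Set.Ioi 0) := by
    apply antitoneOn_of_deriv_nonpos (convex_Ioi 0)
    · intro x hx
      exact (hgd x (ne_of_gt hx)).continuousAt.continuousWithinAt
    · intro x hx
      rw [interior_Ioi] at hx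
      exact (hgd x (ne_of_gt hx)).differentiableAt.differentiableWithinAt
    · intro x hx
      rw [interior_Ioi] at hx
      have hx0 : 0 < x := hx
      rw [(hgd x (ne_of_gt hx)).deriv]
      have := hAdm x hx0.ne'
      rw [le_div_iff₀ hx0] at this
      apply div_nonpos_of_nonpos_of_nonneg _ (by positivity)
      linarith
  have hh : ∀ x : ℝ, HasDerivAt
      (fun x => φ r + (deriv φ r / (2 * r)) * (x ^ 2 - r ^ 2) - φ x)
      ((deriv φ r / (2 * r)) * (2 * x) - deriv φ x) x := by
    intro x
    have h1 : HasDerivAt (fun x : ℝ => x ^ 2) (2 * x) x := by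
      simpa using hasDerivAt_pow 2 x
    exact (((h1.sub_const _).const_mul _).const_add _).sub (hd x).hasDerivAt
  have e : ∀ x : ℝ, 0 < x → (deriv φ r / (2 * r)) * (2 * x) - deriv φ x
      = x * (deriv φ r / r - deriv φ x / x) := by
    intro x hx
    field_simp
  rcases le_total s r with h | h
  · have ha : AntitoneOn (fun x => φ r + (deriv φ r / (2 * r)) * (x ^ 2 - r ^ 2) - φ x)
        (Set.Icc 0 r) := by
      apply antitoneOn_of_deriv_nonpos (convex_Icc 0 r)
      · exact fun x _ => (hh x).continuousAt.continuousWithinAt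
      · exact fun x _ => (hh x).differentiableAt.differentiableWithinAt
      · intro x hx
        rw [interior_Icc] at hx
        rw [(hh x).deriv, e x hx.1]
        have := hg (Set.mem_Ioi.2 hx.1) (Set.mem_Ioi.2 hr) hx.2.le
        exact mul_nonpos_of_nonneg_of_nonpos hx.1.le (sub_nonpos.2 this)
    have := ha ⟨hs, h⟩ ⟨hr.le, le_rfl⟩ h
    simp only [sub_self, mul_zero, add_zero] at this
    linarith
  · have ha : MonotoneOn (fun x => φ r + (deriv φ r / (2 * r)) * (x ^ 2 - r ^ 2) - φ x)
        (Set.Ici r) := by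
      apply monotoneOn_of_deriv_nonneg (convex_Ici r)
      · exact fun x _ => (hh x).continuousAt.continuousWithinAt
      · exact fun x _ => (hh x).differentiableAt.differentiableWithinAt
      · intro x hx
        rw [interior_Ici] at hx
        have hx' : r < x := hx
        have hx0 : 0 < x := hr.trans hx'
        rw [(hh x).deriv, e x hx0]
        have := hg (Set.mem_Ioi.2 hr) (Set.mem_Ioi.2 hx0) hx'.le
        exact mul_nonneg hx0.le (sub_nonneg.2 this)
    have := ha (Set.mem_Ici.2 le_rfl) (Set.mem_Ici.2 h) h
    simp only [sub_self, mul_zero, add_zero] at this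
    linarith

/-- **Majorization property of the reweighted quadratic model.**
If `φ : ℝ → ℝ` is even, twice continuously differentiable, and satisfies
`φ'(x)/x ≥ φ''(x)` for all `x ≠ 0`, then for every `r ≠ 0` and every `s`,
`φ(s) ≤ φ(r) + (φ'(r)/(2r)) (s² − r²)`: the reweighted quadratic model is a
majorant of `φ` which touches `φ` at `s = r`. -/
theorem reweighted_quadratic_majorant
    (φ : ℝ → ℝ)
    (hEven : ∀ x : ℝ, φ (-x) = φ x)
    (hC2 : ContDiff ℝ 2 φ)
    (hAdm : ∀ x : ℝ, x ≠ 0 → deriv (deriv φ) x ≤ deriv φ x / x)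
    (r : ℝ) (hr : r ≠ 0) (s : ℝ) :
    φ s ≤ φ r + (deriv φ r / (2 * r)) * (s ^ 2 - r ^ 2) := by
  have habs : ∀ x : ℝ, φ |x| = φ x := by
    intro x
    rcases abs_choice x with h | h <;> rw [h]
    exact hEven x
  have hodd : deriv φ (-r) = - deriv φ r := by
    have h1 := deriv_comp_neg φ r
    have h2 : (fun x => φ (-x)) = φ := funext hEven
    rw [h2] at h1
    linarith
  have key := majorant_pos φ hC2 hAdm |r| (abs_pos.2 hr) |s| (abs_nonneg s)
  rw [habs, habs, sq_abs, sq_abs] at key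
  have : deriv φ |r| / (2 * |r|) = deriv φ r / (2 * r) := by
    rcases abs_choice r with h | h <;> rw [h]
    rw [hodd, mul_neg, neg_div_neg_eq]
  rwa [this] at key
end

section
/- Let f > 0, let U ⊆ ℝ² be open, and let z : U → ℝ be differentiable at p = (u,v) ∈ U. Define the surface parametrization X : U → ℝ³ by X(u,v) = (z(u,v)/f) · (u, v, f), and the vector n̄(p) = ( f ∂_u z(p), f ∂_v z(p), −z(p) − u ∂_u z(p) − v ∂_v z(p) ) ∈ ℝ³. Then n̄(p) is orthogonal to both partial derivatives ∂_u X(p) and ∂_v X(p), i.e. n̄(p) is a (non-unit-length) normal vector to the surface X at p. -/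
/-- **The vector `n̄(p)` is normal to the perspectively parametrized surface.**
With focal length `f > 0` and a depth map `z` differentiable at `p = (u,v)` in an open
set `U`, the surface `X(u,v) = (z(u,v)/f)·(u,v,f)` has both tangent vectors
`∂ᵤX(p)` and `∂ᵥX(p)` orthogonal to
`n̄(p) = (f ∂ᵤz(p), f ∂ᵥz(p), −z(p) − u ∂ᵤz(p) − v ∂ᵥz(p))`. -/
theorem nbar_is_normal
    (f : ℝ) (hf : 0 < f)
    (U : Set (ℝ × ℝ)) (hU : IsOpen U)
    (z : ℝ × ℝ → ℝ) (p : ℝ × ℝ) (hp : p ∈ U)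
    (hz : DifferentiableAt ℝ z p) :
    let X : ℝ × ℝ → (Fin 3 → ℝ) := fun q => ![z q * q.1 / f, z q * q.2 / f, z q]
    let zu : ℝ := fderiv ℝ z p (1, 0)
    let zv : ℝ := fderiv ℝ z p (0, 1)
    let nbar : Fin 3 → ℝ := ![f * zu, f * zv, -z p - p.1 * zu - p.2 * zv]
    (∑ i, nbar i * fderiv ℝ X p (1, 0) i = 0)
    ∧ (∑ i, nbar i * fderiv ℝ X p (0, 1) i = 0) := by
  intro X zu zv nbar
  have h1 : HasFDerivAt (fun q : ℝ × ℝ => q.1) (ContinuousLinearMap.fst ℝ ℝ ℝ) p := hasFDerivAt_fst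
  have h2 : HasFDerivAt (fun q : ℝ × ℝ => q.2) (ContinuousLinearMap.snd ℝ ℝ ℝ) p := hasFDerivAt_snd
  have hX : HasFDerivAt X (ContinuousLinearMap.pi
      ![f⁻¹ • (z p • ContinuousLinearMap.fst ℝ ℝ ℝ + p.1 • fderiv ℝ z p),
        f⁻¹ • (z p • ContinuousLinearMap.snd ℝ ℝ ℝ + p.2 • fderiv ℝ z p),
        fderiv ℝ z p]) p := by
    rw [hasFDerivAt_pi]
    intro i
    fin_cases i
    · simpa [X, div_eq_mul_inv] using (hz.hasFDerivAt.mul h1).mul_const f⁻¹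
    · simpa [X, div_eq_mul_inv] using (hz.hasFDerivAt.mul h2).mul_const f⁻¹
    · simpa [X] using hz.hasFDerivAt
  have hf' : f ≠ 0 := hf.ne'
  rw [hX.fderiv]
  constructor
  · simp [Fin.sum_univ_three, nbar]
    change f * zu * (f⁻¹ * z p + f⁻¹ * (p.1 * zu)) + f * zv * (f⁻¹ * (p.2 * zu)) + _ * zu = 0
    field_simp
    ring
  · simp [Fin.sum_univ_three, nbar]
    change f * zu * (f⁻¹ * (p.1 * zv)) + f * zv * (f⁻¹ * z p + f⁻¹ * (p.2 * zv)) + _ * zv = 0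
    field_simp
    ring
end

section
/- Let H and M be real symmetric n×n matrices with H positive definite, M positive definite, and 2H − M positive definite. Then the spectral radius of I − H⁻¹ M is strictly less than 1. -/
lemma arls_quad {n : ℕ} {A : Matrix (Fin n) (Fin n) ℝ} (hA : A.PosDef) {v : Fin n → ℂ}
    (hv : v ≠ 0) :
    ∃ r : ℝ, 0 < r ∧ star v ⬝ᵥ ((A.map (algebraMap ℝ ℂ)).mulVec v) = (r : ℂ) := by
  set x : Fin n → ℝ := fun i => (v i).re with hx
  set y : Fin n → ℝ := fun i => (v i).im with hy
  have hs : ∀ i j, A i j = A j i := fun i j => by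
    have := hA.isHermitian.apply j i
    simpa using this
  have hnn : ∀ z : Fin n → ℝ, 0 ≤ z ⬝ᵥ A.mulVec z := fun z => by
    simpa using hA.posSemidef.dotProduct_mulVec_nonneg z
  have hpp : ∀ z : Fin n → ℝ, z ≠ 0 → 0 < z ⬝ᵥ A.mulVec z := fun z hz => by
    simpa using hA.dotProduct_mulVec_pos hz
  refine ⟨x ⬝ᵥ A.mulVec x + y ⬝ᵥ A.mulVec y, ?_, ?_⟩
  · by_cases h : x = 0
    · have hy0 : y ≠ 0 := by
        intro h'
        apply hv
        funext i
        exact Complex.ext (congrFun h i) (congrFun h' i)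
      linarith [hnn x, hpp y hy0]
    · linarith [hnn y, hpp x h]
  · apply Complex.ext
    · simp only [dotProduct, Matrix.mulVec, Complex.ofReal_re, Complex.re_sum, Finset.mul_sum]
      rw [← Finset.sum_add_distrib]
      refine Finset.sum_congr rfl fun i _ => ?_
      rw [← Finset.sum_add_distrib]
      refine Finset.sum_congr rfl fun j _ => ?_
      simp [hx, hy]
    · have h1 : ∑ i, ∑ j, x i * (A i j * y j) = ∑ i, ∑ j, y i * (A i j * x j) := by
        rw [Finset.sum_comm]
        refine Finset.sum_congr rfl fun i _ => Finset.sum_congr rfl fun j _ => ?_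
        rw [hs j i]; ring
      have h2 : (star v ⬝ᵥ ((A.map (algebraMap ℝ ℂ)).mulVec v)).im
          = ∑ i, ∑ j, x i * (A i j * y j) - ∑ i, ∑ j, y i * (A i j * x j) := by
        simp only [dotProduct, Matrix.mulVec, Complex.im_sum, Finset.mul_sum]
        rw [← Finset.sum_sub_distrib]
        refine Finset.sum_congr rfl fun i _ => ?_
        rw [← Finset.sum_sub_distrib]
        refine Finset.sum_congr rfl fun j _ => ?_
        simp [hx, hy]
        ring
      rw [h2, h1]
      simp

/-- **Core spectral estimate in the proof of Theorem 1.**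
Let `H` and `M` be real symmetric `n×n` matrices with `H ≻ 0`, `M ≻ 0` and
`2H − M ≻ 0`. Then the spectral radius of `I − H⁻¹M` is strictly less than `1`. -/
theorem spectral_radius_of_arls_jacobian
    {n : ℕ} (H M : Matrix (Fin n) (Fin n) ℝ)
    (hH : H.PosDef) (hM : M.PosDef)
    (h2 : ((2 : ℝ) • H - M).PosDef) :
    spectralRadius ℂ ((1 - H⁻¹ * M).map (algebraMap ℝ ℂ)) < 1 := by
  have key : ∀ k ∈ spectrum ℂ ((1 - H⁻¹ * M).map (algebraMap ℝ ℂ)), ‖k‖ < 1 := by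
    intro k hk
    rw [← Matrix.spectrum_toLin', ← Module.End.hasEigenvalue_iff_mem_spectrum] at hk
    obtain ⟨v, hv⟩ := hk.exists_hasEigenvector
    have hv0 := hv.2
    have hev : ((1 - H⁻¹ * M).map (algebraMap ℝ ℂ)).mulVec v = k • v := by
      simpa using hv.apply_eq_smul
    have hmul : H * (1 - H⁻¹ * M) = H - M := by
      have hu : IsUnit H.det := (Matrix.isUnit_iff_isUnit_det _).1 hH.isUnit
      rw [mul_sub, mul_one, Matrix.mul_nonsing_inv_cancel_left _ _ hu]
    have hc : (H.map (algebraMap ℝ ℂ)) * ((1 - H⁻¹ * M).map (algebraMap ℝ ℂ))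
        = H.map (algebraMap ℝ ℂ) - M.map (algebraMap ℝ ℂ) := by
      rw [← Matrix.map_mul, hmul, Matrix.map_sub _ (map_sub _)]
    obtain ⟨a, ha, hqa⟩ := arls_quad hH hv0
    obtain ⟨b, hb, hqb⟩ := arls_quad hM hv0
    obtain ⟨c, hcp, hqc⟩ := arls_quad h2 hv0
    have hmap : ((2 : ℝ) • H - M).map (algebraMap ℝ ℂ)
        = (2 : ℂ) • H.map (algebraMap ℝ ℂ) - M.map (algebraMap ℝ ℂ) := by
      ext i j; simp
    rw [hmap, Matrix.sub_mulVec, Matrix.smul_mulVec, dotProduct_sub, dotProduct_smul, hqa, hqb]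
      at hqc
    have e1 : (2 : ℝ) * a - b = c := by
      apply Complex.ofReal_injective
      simpa using hqc
    have e2 : (a : ℂ) - b = k * a := by
      rw [← hqa, ← hqb, ← dotProduct_sub, ← Matrix.sub_mulVec, ← hc, ← Matrix.mulVec_mulVec, hev,
        Matrix.mulVec_smul, dotProduct_smul, smul_eq_mul]
    have e3 : |a - b| = ‖k‖ * a := by
      have := congrArg norm e2
      rw [norm_mul, ← Complex.ofReal_sub, Complex.norm_real, Complex.norm_real,
        Real.norm_eq_abs, Real.norm_eq_abs, abs_of_pos ha] at this
      exact this
    have e4 : |a - b| < a := abs_lt.2 ⟨by linarith, by linarith⟩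
    rw [e3] at e4
    by_contra! h
    nlinarith
  have hfin := Matrix.finite_spectrum ((1 - H⁻¹ * M).map (algebraMap ℝ ℂ))
  unfold spectralRadius
  have hle : (⨆ k ∈ spectrum ℂ ((1 - H⁻¹ * M).map (algebraMap ℝ ℂ)), (‖k‖₊ : ENNReal))
      = hfin.toFinset.sup fun k => (‖k‖₊ : ENNReal) := by
    rw [Finset.sup_eq_iSup]
    simp
  rw [hle, Finset.sup_lt_iff (by simp)]
  intro k hk
  have := key k (by simpa using hk)
  exact_mod_cast this
end
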